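/- (Relation R4 of the intermediate Wakimoto realization.) For all 1 ≤ i, j ≤ n and all m, p ∈ ℤ, [ρ(E_i)_m, ρ(F_j)_p] = δ_{ij} · (ρ(H_i)_{m+p} + (γ² − (r+1)) · m · δ_{m+p,0} · id) as linear operators on ℂ[x] ⊗ ℂ[y]. -/

import Mathlib

open MvPolynomial

/-- The Cartan matrix of `sl(n+1, ℂ)` (indices `0, …, n-1` represent `1, …, n`). -/
def cartan (n : ℕ) (i j : Fin n) : ℤ :=
  if i = j then 2 else if (i : ℕ) + 1 = (j : ℕ) ∨ (j : ℕ) + 1 = (i : ℕ) then -1 else 0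

/-- The pairing `(α_i | α_{kl}) = Σ_{s=k}^{l} A_{is}` of a simple root with the positive
root `α_k + ⋯ + α_l`. -/
def pairRoot (n : ℕ) (i k l : Fin n) : ℤ :=
  ∑ s ∈ Finset.Icc k l, cartan n i s

/-- The matrix `𝔅_{ij} = (α_i|α_j)(γ² − δ_{i>r}δ_{j>r}(r+1) + (r/2)δ_{i,r+1}δ_{j,r+1})`. -/
noncomputable def Bmat (n r : ℕ) (γ : ℂ) (i j : Fin n) : ℂ :=
  (cartan n i j : ℂ) *
    (γ ^ 2 - (if r < (i : ℕ) + 1 ∧ r < (j : ℕ) + 1 then (r : ℂ) + 1 else 0)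
      + (if (i : ℕ) = r ∧ (j : ℕ) = r then (r : ℂ) / 2 else 0))

/-- Index type for the variables of `ℂ[x] ⊗ ℂ[y] ≅ ℂ[x, y]`:  left summands index the
variables `x_{ij,m}` (`1 ≤ i ≤ j ≤ n`, `m ∈ ℤ`; only indices with `i ≤ j` are used),
right summands index the variables `y_{i,m}` (`1 ≤ i ≤ n`, `m ≥ 1`). -/
abbrev Idx (n : ℕ) := (Fin n × Fin n × ℤ) ⊕ (Fin n × ℕ+)

/-- The Fock space `ℂ[x] ⊗ ℂ[y]`, realized as a polynomial ring in both families of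
variables. -/
abbrev PXY (n : ℕ) := MvPolynomial (Idx n) ℂ

/-- The oscillator operator `a_{ij,m} ⊗ 1`. -/
noncomputable def aOp (n r : ℕ) (i j : Fin n) (m : ℤ) : Module.End ℂ (PXY n) :=
  if 0 ≤ m ∧ (j : ℕ) + 1 ≤ r then (pderiv (Sum.inl (i, j, m))).toLinearMap
  else LinearMap.mulLeft ℂ (X (Sum.inl (i, j, m)))

/-- The oscillator operator `a*_{ij,m} ⊗ 1`. -/
noncomputable def aStar (n r : ℕ) (i j : Fin n) (m : ℤ) : Module.End ℂ (PXY n) :=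
  if m ≤ 0 ∧ (j : ℕ) + 1 ≤ r then LinearMap.mulLeft ℂ (X (Sum.inl (i, j, -m)))
  else - (pderiv (Sum.inl (i, j, -m))).toLinearMap

/-- The Heisenberg operator `1 ⊗ b_{i,m}`. -/
noncomputable def bOp (n : ℕ) (e : Fin n → Fin n → ℂ) (lam : Fin n → ℂ)
    (i : Fin n) (m : ℤ) : Module.End ℂ (PXY n) :=
  if hm : 0 < m then
    (m : ℂ) • ∑ k : Fin n, e i k • (pderiv (Sum.inr (k, (⟨m.toNat, by omega⟩ : ℕ+)))).toLinearMap
  else if hm' : m < 0 then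
    ∑ k : Fin n, e i k • LinearMap.mulLeft ℂ (X (Sum.inr (k, (⟨(-m).toNat, by omega⟩ : ℕ+))))
  else lam i • (1 : Module.End ℂ (PXY n))

/-- The normally ordered quadratic operator `N_{kl,m} = Σ_{q∈ℤ} :a_{kl,q} a*_{kl,m-q}:`
(pointwise `finsum`). -/
noncomputable def Nop (n r : ℕ) (k l : Fin n) (m : ℤ) (P : PXY n) : PXY n :=
  ∑ᶠ q : ℤ,
    if 0 ≤ q ∧ (l : ℕ) + 1 ≤ r then aStar n r k l (m - q) (aOp n r k l q P)
    else aOp n r k l q (aStar n r k l (m - q) P)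

/-- The operator `ℋ_{i,m} = Σ_{1 ≤ k ≤ l ≤ n} (α_i|α_{kl}) N_{kl,m}`. -/
noncomputable def Hcal (n r : ℕ) (i : Fin n) (m : ℤ) (P : PXY n) : PXY n :=
  ∑ k : Fin n, ∑ l : Fin n,
    if k ≤ l then (pairRoot n i k l : ℂ) • Nop n r k l m P else 0

/-- The quadratic operator `(a_{kl} a*_{k'l'})_m = Σ_{q∈ℤ} a_{kl,q} a*_{k'l',m-q}`. -/
noncomputable def pairOp (n r : ℕ) (k l k' l' : Fin n) (m : ℤ) (P : PXY n) : PXY n :=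
  ∑ᶠ q : ℤ, aOp n r k l q (aStar n r k' l' (m - q) P)

/-- `Σ_{k=1}^{i-1} (a_{k,i-1} a*_{k,i})_m`. -/
noncomputable def sumLow (n r : ℕ) (i : Fin n) (m : ℤ) (P : PXY n) : PXY n :=
  ∑ k : Fin n, if h : k < i then
    pairOp n r k (⟨(i : ℕ) - 1, by have := i.isLt; omega⟩ : Fin n) k i m P
  else 0

/-- `Σ_{k=i+1}^{n} (a_{i+1,k} a*_{i,k})_m`. -/
noncomputable def sumHigh (n r : ℕ) (i : Fin n) (m : ℤ) (P : PXY n) : PXY n :=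
  ∑ k : Fin n, if h : i < k then
    pairOp n r (⟨(i : ℕ) + 1, by have := k.isLt; have := Fin.lt_def.mp h; omega⟩ : Fin n)
      k i k m P
  else 0

/-- `Σ_{j=i+1}^{n} (a_{i,j} a*_{i+1,j})_m`, the quadratic part of `ρ(F_i)_m`. -/
noncomputable def sumF (n r : ℕ) (i : Fin n) (m : ℤ) (P : PXY n) : PXY n :=
  ∑ j : Fin n, if h : i < j then
    pairOp n r i j (⟨(i : ℕ) + 1, by have := j.isLt; have := Fin.lt_def.mp h; omega⟩ : Fin n)
      j m P
  else 0

/-- `a_{jl,q}` is an annihilation operator iff `q ≥ 0` and `l ≤ r`. -/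
def annAFlag (r : ℕ) {n : ℕ} (l : Fin n) (q : ℤ) : Bool :=
  decide (0 ≤ q ∧ (l : ℕ) + 1 ≤ r)

/-- `a*_{jl,q}` is an annihilation operator iff `q > 0` or `l > r`. -/
def annSFlag (r : ℕ) {n : ℕ} (l : Fin n) (q : ℤ) : Bool :=
  ! decide (q ≤ 0 ∧ (l : ℕ) + 1 ≤ r)

/-- Normally ordered product of three operators (each tagged with its annihilation flag):
annihilation operators are placed to the right of creation operators. -/
noncomputable def nord3 {n : ℕ} (f1 f2 f3 : Module.End ℂ (PXY n) × Bool) :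
    Module.End ℂ (PXY n) :=
  (([f1, f2, f3].filter fun p => !p.2).map Prod.fst).prod *
    (([f1, f2, f3].filter fun p => p.2).map Prod.fst).prod

/-- The mode of `:a*_{ii}(z) a_{kl}(z) a*_{kl}(z):` of `z`-degree `-m-1`. -/
noncomputable def cubic (n r : ℕ) (i k l : Fin n) (m : ℤ) (P : PXY n) : PXY n :=
  ∑ᶠ q : ℤ × ℤ,
    nord3 (aStar n r i i q.1, annSFlag r i q.1)
      (aOp n r k l q.2, annAFlag r l q.2)
      (aStar n r k l (m - q.1 - q.2), annSFlag r l (m - q.1 - q.2)) P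

/-- The mode `ρ(E_i)_m`, the coefficient of `z^{-m-1}` in
`E_i(z) = :a*_{ii}(Σ_{k<i} a_{k,i-1}a*_{k,i-1} − Σ_{k≤i} a_{ki}a*_{ki}):
+ Σ_{k>i} a_{i+1,k}a*_{ik} − Σ_{k<i} a_{k,i-1}a*_{ki} − a*_{ii} b_i
− (δ_{i>r}(r+1) + δ_{i≤r}(i+1) − γ²) ∂a*_{ii}`. -/
noncomputable def rhoE (n r : ℕ) (γ : ℂ) (e : Fin n → Fin n → ℂ) (lam : Fin n → ℂ)
    (i : Fin n) (m : ℤ) (P : PXY n) : PXY n :=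
  (∑ k : Fin n, if h : k < i then
      cubic n r i k (⟨(i : ℕ) - 1, by have := i.isLt; omega⟩ : Fin n) m P
    else 0)
  - (∑ k : Fin n, if k ≤ i then cubic n r i k i m P else 0)
  + sumHigh n r i m P
  - sumLow n r i m P
  - (∑ᶠ q : ℤ, aStar n r i i q (bOp n e lam i (m - q) P))
  - ((if r < (i : ℕ) + 1 then (r : ℂ) + 1 else 0)
      + (if (i : ℕ) + 1 ≤ r then ((i : ℕ) : ℂ) + 2 else 0) - γ ^ 2) •
      ((-(m : ℂ)) • aStar n r i i m P)

/-- The mode `ρ(H_i)_m = ℋ_{i,m} ⊗ 1 + 1 ⊗ b_{i,m}`. -/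
noncomputable def rhoH (n r : ℕ) (e : Fin n → Fin n → ℂ) (lam : Fin n → ℂ)
    (i : Fin n) (m : ℤ) (P : PXY n) : PXY n :=
  Hcal n r i m P + bOp n e lam i m P

/-- The mode `ρ(F_i)_m = a_{ii,m} ⊗ 1 + Σ_{j=i+1}^{n} (a_{ij} a*_{i+1,j})_m ⊗ 1`. -/
noncomputable def rhoF (n r : ℕ) (i : Fin n) (m : ℤ) (P : PXY n) : PXY n :=
  aOp n r i i m P + sumF n r i m P

section OperatorSums

variable {V ι κ : Type*} [AddCommGroup V] [Module ℂ V]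

/-- The commutator of two operators, as a bilinear map. -/
noncomputable def opComm : Module.End ℂ V →ₗ[ℂ] Module.End ℂ V →ₗ[ℂ] Module.End ℂ V :=
  LinearMap.mul ℂ _ - (LinearMap.mul ℂ _).flip

theorem opComm_apply (X Y : Module.End ℂ V) : opComm X Y = X * Y - Y * X := rfl

theorem opComm_skew (X Y : Module.End ℂ V) : opComm X Y = -opComm Y X := by
  simp [opComm_apply]

theorem opComm_mul_left (X Y Z : Module.End ℂ V) :
    opComm (X * Y) Z = opComm X Z * Y + X * opComm Y Z := by
  simp only [opComm_apply]
  noncomm_ring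

theorem opComm_mul_right (X Y Z : Module.End ℂ V) :
    opComm X (Y * Z) = opComm X Y * Z + Y * opComm X Z := by
  simp only [opComm_apply]
  noncomm_ring

theorem commute_of_opComm {X Y : Module.End ℂ V} (h : opComm X Y = 0) : Commute X Y :=
  sub_eq_zero.1 h

theorem commute_smul_left {X Y : Module.End ℂ V} (h : Commute X Y) (c : ℂ) :
    Commute (c • X) Y := by
  refine LinearMap.ext fun v => ?_
  have hv := LinearMap.congr_fun h.eq v
  simp only [Module.End.mul_apply, LinearMap.smul_apply, map_smul] at hv ⊢
  rw [hv]

theorem commute_neg_right {X Y : Module.End ℂ V} (h : Commute X Y) : Commute X (-Y) :=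
  h.neg_right

/-- The family of operators `A` is pointwise finite and sums pointwise to `T`. -/
def HasOpSum (A : ι → Module.End ℂ V) (T : Module.End ℂ V) : Prop :=
  ∀ v, (fun q => A q v).HasFiniteSupport ∧ ∑ᶠ q, A q v = T v

open Classical in
/-- The pointwise sum of a pointwise finite family of operators (and `0` otherwise). -/
noncomputable def opSum (A : ι → Module.End ℂ V) : Module.End ℂ V :=
  if h : ∀ v, (fun q => A q v).HasFiniteSupport then
    { toFun := fun v => ∑ᶠ q, A q v
      map_add' := fun v w => by
        simp only [map_add]
        exact finsum_add_distrib (h v) (h w)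
      map_smul' := fun c v => by
        simp only [map_smul, RingHom.id_apply, smul_finsum] }
  else 0

theorem hasOpSum_opSum {A : ι → Module.End ℂ V} (h : ∀ v, (fun q => A q v).HasFiniteSupport) :
    HasOpSum A (opSum A) := fun v => ⟨h v, by simp [opSum, h]⟩

namespace HasOpSum

variable {A B : ι → Module.End ℂ V} {S T : Module.End ℂ V}

theorem unique (hS : HasOpSum A S) (hT : HasOpSum A T) : S = T :=
  LinearMap.ext fun v => (hS v).2.symm.trans (hT v).2

theorem congr (hT : HasOpSum A T) (h : ∀ q, A q = B q) : HasOpSum B T :=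
  funext h ▸ hT

protected theorem add (hS : HasOpSum A S) (hT : HasOpSum B T) :
    HasOpSum (fun q => A q + B q) (S + T) := fun v =>
  ⟨(hS v).1.fun_add (hT v).1, by
    simp only [LinearMap.add_apply, ← (hS v).2, ← (hT v).2]
    exact finsum_add_distrib (hS v).1 (hT v).1⟩

protected theorem neg (hS : HasOpSum A S) : HasOpSum (fun q => -A q) (-S) := fun v =>
  ⟨(hS v).1.fun_neg, by
    simp only [LinearMap.neg_apply, ← (hS v).2]
    exact finsum_neg_distrib _⟩

protected theorem sub (hS : HasOpSum A S) (hT : HasOpSum B T) :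
    HasOpSum (fun q => A q - B q) (S - T) := by
  simpa only [sub_eq_add_neg] using hS.add hT.neg

theorem opComm_left (hT : HasOpSum A T) (X : Module.End ℂ V) :
    HasOpSum (fun q => opComm (A q) X) (opComm T X) := by
  intro v
  have h1 := (hT (X v)).1
  have h2 : (fun q => X (A q v)).HasFiniteSupport :=
    (hT v).1.subset fun q hq h0 => hq (by simp_all)
  refine ⟨?_, ?_⟩
  · simpa [opComm_apply] using h1.fun_sub h2
  · simp only [opComm_apply, LinearMap.sub_apply, Module.End.mul_apply]
    rw [finsum_sub_distrib h1 h2, (hT (X v)).2, ← (hT v).2, map_finsum X (hT v).1]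

theorem opComm_right (hT : HasOpSum A T) (X : Module.End ℂ V) :
    HasOpSum (fun q => opComm X (A q)) (opComm X T) := by
  rw [opComm_skew X T]
  exact (hT.opComm_left X).neg.congr (B := fun q => opComm X (A q))
    fun q => (opComm_skew X (A q)).symm

/-- Change of the index set along an injection outside of whose range the family vanishes. -/
theorem of_injective {C : κ → Module.End ℂ V} (hT : HasOpSum C T) (f : κ → ι)
    (hf : Function.Injective f) (hA : ∀ k, A (f k) = C k) (h0 : ∀ q, q ∉ Set.range f → A q = 0) :
    HasOpSum A T := by
  intro v
  have hs : (Function.support fun q => A q v) ⊆ Set.range f := fun q hq => by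
    by_contra h
    exact hq (by simp [h0 q h])
  refine ⟨((hT v).1.image f).subset fun q hq => ?_, ?_⟩
  · obtain ⟨k, rfl⟩ := hs hq
    exact ⟨k, by simpa [hA] using hq, rfl⟩
  · rw [← (hT v).2, ← finsum_mem_univ, finsum_mem_inter_support_eq' _ Set.univ (Set.range f)
      (fun q hq => by simpa using hs hq), finsum_mem_range hf]
    simp only [hA]

theorem zero : HasOpSum (fun _ : ι => (0 : Module.End ℂ V)) 0 := fun v =>
  ⟨by simp [Function.HasFiniteSupport], by simp⟩

theorem single (q₀ : ι) (h0 : ∀ q, q ≠ q₀ → A q = 0) : HasOpSum A (A q₀) :=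
  of_injective (C := fun _ : Unit => A q₀) (fun _ => ⟨Set.toFinite _, finsum_unique _⟩)
    (fun _ => q₀)
    (fun _ _ _ => rfl) (fun _ => rfl) (fun q hq => h0 q fun h => hq ⟨(), h.symm⟩)

theorem comp_equiv (hT : HasOpSum A T) (f : κ ≃ ι) : HasOpSum (fun k => A (f k)) T :=
  hT.of_injective f.symm f.symm.injective (by simp) fun q hq => (hq ⟨f q, by simp⟩).elim

end HasOpSum

end OperatorSums

section Oscillators

section Polynomial

variable {σ : Type*}

/-- Partial differentiation, as an endomorphism. -/
noncomputable def derOp (v : σ) : Module.End ℂ (MvPolynomial σ ℂ) := (pderiv v).toLinearMap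

/-- Multiplication by a variable, as an endomorphism. -/
noncomputable def mulOp (v : σ) : Module.End ℂ (MvPolynomial σ ℂ) := LinearMap.mulLeft ℂ (X v)

theorem opComm_derOp_derOp (v w : σ) : opComm (derOp v) (derOp w) = 0 := by
  classical
  have h : ⁅(pderiv v : Derivation ℂ (MvPolynomial σ ℂ) (MvPolynomial σ ℂ)), pderiv w⁆ = 0 :=
    MvPolynomial.derivation_ext fun i => by
      rw [Derivation.commutator_apply]
      simp only [pderiv_X, Pi.single_apply]
      split_ifs <;> simp
  refine LinearMap.ext fun P => ?_
  have h' := congrArg (fun D : Derivation ℂ (MvPolynomial σ ℂ) (MvPolynomial σ ℂ) => D P) h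
  simpa [Derivation.commutator_apply, opComm_apply, derOp] using h'

theorem opComm_derOp_mulOp [DecidableEq σ] (v w : σ) :
    opComm (derOp v) (mulOp w) = if v = w then 1 else 0 := by
  refine LinearMap.ext fun P => ?_
  split_ifs with h
  · subst h
    simp [opComm_apply, Derivation.leibniz, derOp, mulOp]
  · simp [opComm_apply, Derivation.leibniz, derOp, mulOp, pderiv_X, Ne.symm h]

theorem opComm_mulOp_mulOp (v w : σ) : opComm (mulOp v) (mulOp w) = 0 := by
  refine LinearMap.ext fun P => ?_
  simp [opComm_apply, mulOp, mul_left_comm]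

theorem opComm_mulOp_derOp [DecidableEq σ] (v w : σ) :
    opComm (mulOp v) (derOp w) = if v = w then -1 else 0 := by
  rw [opComm_skew, opComm_derOp_mulOp]
  simp only [eq_comm (a := v)]
  split_ifs <;> simp

theorem mem_vars_of_derOp_ne_zero {v : σ} {P : MvPolynomial σ ℂ} (h : derOp v P ≠ 0) :
    v ∈ P.vars := by
  by_contra hv
  exact h (pderiv_eq_zero_of_notMem_vars hv)

end Polynomial

variable {n r : ℕ}

theorem aOp_eq (k l : Fin n) (q : ℤ) : aOp n r k l q =
    if 0 ≤ q ∧ (l : ℕ) + 1 ≤ r then derOp (Sum.inl (k, l, q)) else mulOp (Sum.inl (k, l, q)) := rfl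

theorem aStar_eq (k l : Fin n) (q : ℤ) : aStar n r k l q =
    if q ≤ 0 ∧ (l : ℕ) + 1 ≤ r then mulOp (Sum.inl (k, l, -q)) else -derOp (Sum.inl (k, l, -q)) :=
  rfl

/-- A positive integer as an element of `ℕ+`. -/
def posMode (q : ℤ) (hq : 0 < q) : ℕ+ := ⟨q.toNat, by omega⟩

theorem bOp_eq (e : Fin n → Fin n → ℂ) (lam : Fin n → ℂ) (i : Fin n) (q : ℤ) : bOp n e lam i q =
    if hq : 0 < q then
      (q : ℂ) • ∑ k, e i k • derOp (Sum.inr (k, posMode q hq))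
    else if hq' : q < 0 then
      ∑ k, e i k • mulOp (Sum.inr (k, posMode (-q) (neg_pos.2 hq')))
    else lam i • 1 := rfl

theorem opComm_aOp_aOp (k l k' l' : Fin n) (q s : ℤ) :
    opComm (aOp n r k l q) (aOp n r k' l' s) = 0 := by
  rw [aOp_eq, aOp_eq]
  split_ifs with h1 h2 h2
  · exact opComm_derOp_derOp _ _
  · rw [opComm_derOp_mulOp, if_neg]
    rintro ⟨⟩
    exact h2 h1
  · rw [opComm_mulOp_derOp, if_neg]
    rintro ⟨⟩
    exact h1 h2
  · exact opComm_mulOp_mulOp _ _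

theorem opComm_aStar_aStar (k l k' l' : Fin n) (q s : ℤ) :
    opComm (aStar n r k l q) (aStar n r k' l' s) = 0 := by
  rw [aStar_eq, aStar_eq]
  split_ifs with h1 h2 h2
  · exact opComm_mulOp_mulOp _ _
  · rw [map_neg, opComm_mulOp_derOp, if_neg, neg_zero]
    intro h
    simp only [Sum.inl.injEq, Prod.mk.injEq, neg_inj] at h
    obtain ⟨rfl, rfl, rfl⟩ := h
    exact h2 h1
  · rw [LinearMap.map_neg₂, opComm_derOp_mulOp, if_neg, neg_zero]
    intro h
    simp only [Sum.inl.injEq, Prod.mk.injEq, neg_inj] at h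
    obtain ⟨rfl, rfl, rfl⟩ := h
    exact h1 h2
  · rw [LinearMap.map_neg₂, map_neg, opComm_derOp_derOp, neg_zero, neg_zero]

theorem opComm_aOp_aStar (k l k' l' : Fin n) (q s : ℤ) :
    opComm (aOp n r k l q) (aStar n r k' l' s) = if k = k' ∧ l = l' ∧ q + s = 0 then 1 else 0 := by
  have key : (Sum.inl (k, l, q) : Idx n) = Sum.inl (k', l', -s) ↔ k = k' ∧ l = l' ∧ q + s = 0 := by
    simp only [Sum.inl.injEq, Prod.mk.injEq, eq_neg_iff_add_eq_zero]
  rw [aOp_eq, aStar_eq]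
  by_cases h1 : 0 ≤ q ∧ (l : ℕ) + 1 ≤ r <;> by_cases h2 : s ≤ 0 ∧ (l' : ℕ) + 1 ≤ r
  · simp only [if_pos h1, if_pos h2, opComm_derOp_mulOp, key]
  · rw [if_pos h1, if_neg h2, map_neg, opComm_derOp_derOp, neg_zero, if_neg]
    rintro ⟨rfl, rfl, h⟩
    omega
  · rw [if_neg h1, if_pos h2, opComm_mulOp_mulOp, if_neg]
    rintro ⟨rfl, rfl, h⟩
    omega
  · simp only [if_neg h1, if_neg h2, map_neg, opComm_mulOp_derOp, key]
    split_ifs <;> simp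

theorem commute_bOp (e : Fin n → Fin n → ℂ) (lam : Fin n → ℂ) (i : Fin n) (q : ℤ)
    {T : Module.End ℂ (PXY n)} (hd : ∀ v, Commute (derOp (Sum.inr v)) T)
    (hm : ∀ v, Commute (mulOp (Sum.inr v)) T) : Commute (bOp n e lam i q) T := by
  rw [bOp_eq]
  split_ifs
  · exact commute_smul_left (Commute.sum_left _ _ _ fun k _ => commute_smul_left (hd _) _) _
  · exact Commute.sum_left _ _ _ fun k _ => commute_smul_left (hm _) _
  · exact commute_smul_left (Commute.one_left _) _

theorem commute_bOp_aOp (e : Fin n → Fin n → ℂ) (lam : Fin n → ℂ) (i k l : Fin n) (q s : ℤ) :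
    Commute (bOp n e lam i q) (aOp n r k l s) := by
  rw [aOp_eq]
  split_ifs
  · exact commute_bOp e lam i q (fun v => commute_of_opComm (opComm_derOp_derOp _ _))
      fun v => commute_of_opComm (by simp [opComm_mulOp_derOp])
  · exact commute_bOp e lam i q (fun v => commute_of_opComm (by simp [opComm_derOp_mulOp]))
      fun v => commute_of_opComm (opComm_mulOp_mulOp _ _)

theorem commute_bOp_aStar (e : Fin n → Fin n → ℂ) (lam : Fin n → ℂ) (i k l : Fin n) (q s : ℤ) :
    Commute (bOp n e lam i q) (aStar n r k l s) := by
  rw [aStar_eq]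
  split_ifs
  · exact commute_bOp e lam i q (fun v => commute_of_opComm (by simp [opComm_derOp_mulOp]))
      fun v => commute_of_opComm (opComm_mulOp_mulOp _ _)
  · exact commute_bOp e lam i q
      (fun v => commute_neg_right (commute_of_opComm (opComm_derOp_derOp _ _)))
      fun v => commute_neg_right (commute_of_opComm (by simp [opComm_mulOp_derOp]))

/-- The absolute value of the mode of a variable. -/
def absMode (v : Idx n) : ℤ := Sum.elim (fun x => |x.2.2|) (fun x => (x.2 : ℤ)) v

theorem exists_mode_bound (e : Fin n → Fin n → ℂ) (lam : Fin n → ℂ) (P : PXY n) : ∃ N : ℤ,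
    0 ≤ N ∧ (∀ k l q, aOp n r k l q P ≠ 0 → (l : ℕ) + 1 ≤ r → q ≤ N) ∧
      (∀ k l q, aStar n r k l q P ≠ 0 → q ≤ N ∧ (r < (l : ℕ) + 1 → -N ≤ q)) ∧
      ∀ i q, bOp n e lam i q P ≠ 0 → q ≤ N := by
  obtain ⟨M, hM⟩ := (P.vars.image absMode).exists_le
  have hM' : ∀ v ∈ P.vars, absMode v ≤ M := fun v hv => hM _ (Finset.mem_image_of_mem _ hv)
  refine ⟨max M 0, le_max_right _ _, fun k l q h hl => ?_, fun k l q h => ?_, fun i q h => ?_⟩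
  · by_cases hq : 0 ≤ q
    · rw [aOp_eq, if_pos ⟨hq, hl⟩] at h
      have := hM' _ (mem_vars_of_derOp_ne_zero h)
      simp only [absMode, Sum.elim_inl] at this
      exact le_max_of_le_left ((le_abs_self q).trans this)
    · exact le_max_of_le_right (by omega)
  · by_cases hq : q ≤ 0 ∧ (l : ℕ) + 1 ≤ r
    · exact ⟨le_max_of_le_right hq.1, fun h => by omega⟩
    · rw [aStar_eq, if_neg hq, LinearMap.neg_apply, neg_ne_zero] at h
      have := hM' _ (mem_vars_of_derOp_ne_zero h)
      simp only [absMode, Sum.elim_inl, abs_neg] at this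
      have h1 := abs_le.1 (this.trans (le_max_left M 0))
      exact ⟨h1.2, fun _ => h1.1⟩
  · by_cases hq : 0 < q
    · rw [bOp_eq, dif_pos hq] at h
      obtain ⟨k, hk⟩ : ∃ k, derOp (Sum.inr (k, posMode q hq)) P ≠ 0 := by
        by_contra! h0
        exact h (by simp [LinearMap.sum_apply, h0])
      have := hM' _ (mem_vars_of_derOp_ne_zero hk)
      have hq' : ((posMode q hq : ℕ+) : ℤ) = q := Int.toNat_of_nonneg hq.le
      simp only [absMode, Sum.elim_inr, hq'] at this
      exact le_max_of_le_left this
    · exact le_max_of_le_right (by omega)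

end Oscillators

section Families

variable {n r : ℕ}

/-- The summands of `(a_{kl} a*_{k'l'})_m`. -/
noncomputable def pairFam (r : ℕ) (k l k' l' : Fin n) (m q : ℤ) : Module.End ℂ (PXY n) :=
  aOp n r k l q * aStar n r k' l' (m - q)

/-- The summands of `N_{kl,m}`. -/
noncomputable def normFam (r : ℕ) (k l : Fin n) (m q : ℤ) : Module.End ℂ (PXY n) :=
  if 0 ≤ q ∧ (l : ℕ) + 1 ≤ r then aStar n r k l (m - q) * aOp n r k l q
  else aOp n r k l q * aStar n r k l (m - q)

/-- The summands of the mode of `:a*_{ii}(z) a_{kl}(z) a*_{k'l}(z):`. -/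
noncomputable def cubicFam (r : ℕ) (i k k' l : Fin n) (m : ℤ) (q : ℤ × ℤ) :
    Module.End ℂ (PXY n) :=
  nord3 (aStar n r i i q.1, annSFlag r i q.1) (aOp n r k l q.2, annAFlag r l q.2)
    (aStar n r k' l (m - q.1 - q.2), annSFlag r l (m - q.1 - q.2))

theorem annAFlag_iff {l : Fin n} {q : ℤ} : annAFlag r l q = true ↔ 0 ≤ q ∧ (l : ℕ) + 1 ≤ r := by
  simp [annAFlag]

theorem annSFlag_iff {l : Fin n} {q : ℤ} :
    annSFlag r l q = true ↔ ¬(q ≤ 0 ∧ (l : ℕ) + 1 ≤ r) := by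
  rw [annSFlag, Bool.not_eq_true', decide_eq_false_iff_not]

theorem commute_aStar_aStar (k l k' l' : Fin n) (q s : ℤ) :
    Commute (aStar n r k l q) (aStar n r k' l' s) :=
  commute_of_opComm (opComm_aStar_aStar ..)

theorem commute_aOp_aStar {k l k' l' : Fin n} {q s : ℤ} (h : ¬(k = k' ∧ l = l' ∧ q + s = 0)) :
    Commute (aOp n r k l q) (aStar n r k' l' s) :=
  commute_of_opComm (by rw [opComm_aOp_aStar, if_neg h])

theorem commute_of_annFlag {k l k' l' : Fin n} {q s : ℤ} (hq : annAFlag r l q = true)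
    (hs : annSFlag r l' s = true) : Commute (aOp n r k l q) (aStar n r k' l' s) := by
  refine commute_aOp_aStar ?_
  rintro ⟨rfl, rfl, h⟩
  rw [annAFlag_iff] at hq
  rw [annSFlag_iff] at hs
  omega

theorem right_ne_zero {A B : Module.End ℂ (PXY n)} {P : PXY n} (h : (A * B) P ≠ 0) : B P ≠ 0 := by
  intro h0
  exact h (by rw [Module.End.mul_apply, h0, map_zero])

section Nord3

variable {f g h : Module.End ℂ (PXY n)} {a b c : Bool}

theorem nord3_ne_zero (hfg : a → b → Commute f g) (hfh : a → c → Commute f h)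
    (hgh : b → c → Commute g h) {P : PXY n} (hP : nord3 (f, a) (g, b) (h, c) P ≠ 0) :
    (a → f P ≠ 0) ∧ (b → g P ≠ 0) ∧ (c → h P ≠ 0) := by
  cases a <;> cases b <;> cases c <;>
    simp only [Bool.false_eq_true, IsEmpty.forall_iff, forall_const, true_and, and_true,
      nord3, List.filter, Bool.not_true, Bool.not_false, List.map_cons, List.map_nil,
      List.prod_cons, List.prod_nil, mul_one, one_mul] at *
  · exact right_ne_zero hP
  · exact right_ne_zero hP
  · exact ⟨right_ne_zero (A := f * h) (by rwa [mul_assoc, ← hgh.eq]),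
      right_ne_zero (A := f * g) (by rwa [mul_assoc])⟩
  · exact right_ne_zero hP
  · exact ⟨right_ne_zero (A := g * h) (by rwa [mul_assoc, ← hfh.eq]),
      right_ne_zero (A := g * f) (by rwa [mul_assoc])⟩
  · exact ⟨right_ne_zero (A := h * g) (by rwa [mul_assoc, ← hfg.eq]),
      right_ne_zero (A := h * f) (by rwa [mul_assoc])⟩
  · exact ⟨right_ne_zero (A := g * h) (by rwa [mul_assoc, ← hfh.eq, ← mul_assoc, ← hfg.eq,
        mul_assoc]),
      right_ne_zero (A := f * h) (by rwa [mul_assoc, ← hgh.eq]),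
      right_ne_zero (A := f * g) (by rwa [mul_assoc])⟩

theorem nord3_of_commute (hfg : Commute f g) (hfh : Commute f h) (hgh : Commute g h) :
    nord3 (f, a) (g, b) (h, c) = f * g * h := by
  have e1 := hfg.eq
  have e2 := hfh.eq
  have e3 := hgh.eq
  cases a <;> cases b <;> cases c <;>
    simp only [nord3, List.filter, Bool.not_true, Bool.not_false, List.map_cons, List.map_nil,
      List.prod_cons, List.prod_nil, mul_one, one_mul, mul_assoc]
  all_goals grind [mul_assoc]

theorem opComm_nord3 (T : Module.End ℂ (PXY n)) :
    opComm (nord3 (f, a) (g, b) (h, c)) T =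
      nord3 (opComm f T, a) (g, b) (h, c) + nord3 (f, a) (opComm g T, b) (h, c) +
        nord3 (f, a) (g, b) (opComm h T, c) := by
  cases a <;> cases b <;> cases c <;>
    simp only [nord3, List.filter, Bool.not_true, Bool.not_false, List.map_cons, List.map_nil,
      List.prod_cons, List.prod_nil, mul_one, one_mul, opComm_mul_left, mul_add,
      mul_assoc] <;>
    abel

theorem nord3_zero_left : nord3 (0, a) (g, b) (h, c) = 0 := by
  cases a <;> cases b <;> cases c <;> simp [nord3]

theorem nord3_zero_mid : nord3 (f, a) (0, b) (h, c) = 0 := by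
  cases a <;> cases b <;> cases c <;> simp [nord3]

theorem nord3_zero_right : nord3 (f, a) (g, b) (0, c) = 0 := by
  cases a <;> cases b <;> cases c <;> simp [nord3]

theorem nord3_neg_left : nord3 (-f, a) (g, b) (h, c) = -nord3 (f, a) (g, b) (h, c) := by
  refine LinearMap.ext fun P => ?_
  cases a <;> cases b <;> cases c <;> simp [nord3]

theorem nord3_neg_sub_right (h' : Module.End ℂ (PXY n)) :
    nord3 (f, a) (g, b) (-h - h', c) =
      -nord3 (f, a) (g, b) (h, c) - nord3 (f, a) (g, b) (h', c) := by
  refine LinearMap.ext fun P => ?_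
  cases a <;> cases b <;> cases c <;> simp [nord3]

end Nord3

theorem nord3_one_left (a : Bool) (k l : Fin n) (q s : ℤ) :
    nord3 (1, a) (aOp n r k l q, annAFlag r l q) (aStar n r k l (s - q), annSFlag r l (s - q)) =
      normFam r k l s q := by
  have hc := @commute_of_annFlag n r k l k l q (s - q)
  simp only [normFam, ← annAFlag_iff]
  generalize annAFlag r l q = b at *
  generalize annSFlag r l (s - q) = c at *
  cases a <;> cases b <;> cases c <;> simp_all [nord3, Commute, SemiconjBy]

theorem nord3_one_right (c : Bool) (k l : Fin n) (q s : ℤ) :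
    nord3 (aStar n r k l (s - q), annSFlag r l (s - q)) (aOp n r k l q, annAFlag r l q) (1, c) =
      normFam r k l s q := by
  have hc : annAFlag r l q = false → annSFlag r l (s - q) = false →
      Commute (aOp n r k l q) (aStar n r k l (s - q)) := by
    simp only [← Bool.not_eq_true, annAFlag_iff, annSFlag_iff, not_not]
    intro h1 h2
    refine commute_aOp_aStar ?_
    rintro ⟨-, -, h⟩
    omega
  simp only [normFam, ← annAFlag_iff]
  generalize annAFlag r l q = b at *
  generalize annSFlag r l (s - q) = d at *
  cases c <;> cases b <;> cases d <;> simp_all [nord3, Commute, SemiconjBy]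

theorem hasOpSum_pairFam {k l k' l' : Fin n} (hne : ¬(k = k' ∧ l = l')) (hl : l ≤ l') (m : ℤ) :
    HasOpSum (pairFam r k l k' l' m) (opSum (pairFam r k l k' l' m)) := by
  refine hasOpSum_opSum fun P => ?_
  obtain ⟨N, hN, hA, hS, -⟩ := exists_mode_bound (r := r) 0 0 P
  refine (Set.finite_Icc (m - N) (|m| + N)).subset fun q hq => ?_
  have h1 : aStar n r k' l' (m - q) P ≠ 0 := right_ne_zero hq
  have h2 : aOp n r k l q P ≠ 0 := by
    refine right_ne_zero (A := aStar n r k' l' (m - q)) ?_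
    rw [← (commute_aOp_aStar fun h => hne ⟨h.1, h.2.1⟩).eq]
    exact hq
  have h3 := hS _ _ _ h1
  have h4 := hA _ _ _ h2
  have h5 := le_abs_self m
  have h6 := abs_nonneg m
  rw [Fin.le_def] at hl
  constructor <;> omega

theorem hasOpSum_normFam (k l : Fin n) (m : ℤ) :
    HasOpSum (normFam r k l m) (opSum (normFam r k l m)) := by
  refine hasOpSum_opSum fun P => ?_
  obtain ⟨N, hN, hA, hS, -⟩ := exists_mode_bound (r := r) 0 0 P
  refine (Set.finite_Icc (-|m| - N) (|m| + N)).subset fun q hq => ?_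
  have h5 := le_abs_self m
  have h6 := neg_abs_le m
  rw [Function.mem_support, normFam] at hq
  split_ifs at hq with h
  · have := hA _ _ _ (right_ne_zero hq)
    constructor <;> omega
  · have := hS _ _ _ (right_ne_zero hq)
    constructor <;> omega

theorem hasOpSum_cubicFam {i l : Fin n} (hl : l ≤ i) (k k' : Fin n) (m : ℤ) :
    HasOpSum (cubicFam r i k k' l m) (opSum (cubicFam r i k k' l m)) := by
  refine hasOpSum_opSum fun P => ?_
  obtain ⟨N, hN, hA, hS, -⟩ := exists_mode_bound (r := r) 0 0 P
  refine ((Set.finite_Icc (-|m| - 2 * N) (|m| + 2 * N)).prod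
    (Set.finite_Icc (-|m| - 2 * N) (|m| + 2 * N))).subset fun q hq => ?_
  obtain ⟨h1, h2, h3⟩ := nord3_ne_zero (fun h1 h2 => (commute_of_annFlag h2 h1).symm)
    (fun _ _ => commute_aStar_aStar ..) (fun h1 h2 => commute_of_annFlag h1 h2) hq
  have g1 := fun h => hS _ _ _ (h1 h)
  have g2 := fun h => hA _ _ _ (h2 h)
  have g3 := fun h => hS _ _ _ (h3 h)
  rw [annSFlag_iff] at g1 g3
  rw [annAFlag_iff] at g2
  have h5 := le_abs_self m
  have h6 := neg_abs_le m
  rw [Fin.le_def] at hl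
  simp only [Set.mem_prod, Set.mem_Icc]
  by_cases c1 : (l : ℕ) + 1 ≤ r
  · have q1 : q.1 ≤ N := by
      by_cases c : q.1 ≤ 0 ∧ (i : ℕ) + 1 ≤ r
      · omega
      · exact (g1 c).1
    have q2 : q.2 ≤ N := by
      by_cases c : 0 ≤ q.2
      · exact g2 ⟨c, c1⟩ c1
      · omega
    have q3 : m - q.1 - q.2 ≤ N := by
      by_cases c : m - q.1 - q.2 ≤ 0
      · omega
      · exact (g3 fun h => c h.1).1
    omega
  · have q1 := g1 (by omega)
    have q3 := g3 (by omega)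
    omega

theorem hasOpSum_aStar_mul_bOp (e : Fin n → Fin n → ℂ) (lam : Fin n → ℂ) (i : Fin n) (m : ℤ) :
    HasOpSum (fun q => aStar n r i i q * bOp n e lam i (m - q))
      (opSum fun q => aStar n r i i q * bOp n e lam i (m - q)) := by
  refine hasOpSum_opSum fun P => ?_
  obtain ⟨N, hN, -, hS, hB⟩ := exists_mode_bound (r := r) e lam P
  refine (Set.finite_Icc (m - N) N).subset fun q hq => ?_
  have h1 := hB _ _ (right_ne_zero hq)
  have h2 : aStar n r i i q P ≠ 0 := by
    refine right_ne_zero (A := bOp n e lam i (m - q)) ?_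
    rw [(commute_bOp_aStar ..).eq]
    exact hq
  have h3 := hS _ _ _ h2
  constructor <;> omega

end Families

section Realization

variable {n r : ℕ}

/-- The index `i - 1` (and `0` for `i = 0`). -/
def prv (i : Fin n) : Fin n := ⟨(i : ℕ) - 1, by have := i.isLt; omega⟩

/-- The index `i + 1` (and `i` for the last index). -/
def nxt (i : Fin n) : Fin n := if h : (i : ℕ) + 1 < n then ⟨(i : ℕ) + 1, h⟩ else i

theorem prv_val (i : Fin n) : (prv i : ℕ) = (i : ℕ) - 1 := rfl

theorem nxt_val {i l : Fin n} (h : i < l) : (nxt i : ℕ) = (i : ℕ) + 1 := by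
  have := l.isLt
  rw [Fin.lt_def] at h
  rw [nxt, dif_pos (by omega)]

theorem nxt_ne {i l : Fin n} (h : i < l) : i ≠ nxt i := by
  intro h'
  have := congrArg Fin.val h'
  rw [nxt_val h] at this
  omega

theorem opComm_aOp_opSum_pairFam {a b c d : Fin n} (hne : ¬(a = c ∧ b = d)) (hl : b ≤ d)
    (k l : Fin n) (q p : ℤ) :
    opComm (aOp n r k l q) (opSum (pairFam r a b c d p)) =
      if k = c ∧ l = d then aOp n r a b (q + p) else 0 := by
  have key : ∀ q', opComm (aOp n r k l q) (pairFam r a b c d p q') =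
      if k = c ∧ l = d ∧ q + (p - q') = 0 then aOp n r a b q' else 0 := fun q' => by
    rw [pairFam, opComm_mul_right, opComm_aOp_aOp, opComm_aOp_aStar]
    split_ifs <;> simp
  refine ((hasOpSum_pairFam hne hl p).opComm_right _).unique ?_
  refine HasOpSum.congr ?_ fun q' => (key q').symm
  split_ifs with h
  · convert HasOpSum.single (q + p) _ using 1
    · rw [if_pos ⟨h.1, h.2, by ring⟩]
    · exact fun q' hq' => if_neg fun h' => hq' (by omega)
  · exact HasOpSum.zero.congr fun q' => (if_neg fun h' => h ⟨h'.1, h'.2.1⟩).symm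

theorem opComm_aStar_opSum_pairFam {a b c d : Fin n} (hne : ¬(a = c ∧ b = d)) (hl : b ≤ d)
    (k l : Fin n) (q p : ℤ) :
    opComm (aStar n r k l q) (opSum (pairFam r a b c d p)) =
      if k = a ∧ l = b then -aStar n r c d (q + p) else 0 := by
  have key : ∀ q', opComm (aStar n r k l q) (pairFam r a b c d p q') =
      if k = a ∧ l = b ∧ q' + q = 0 then -aStar n r c d (p - q') else 0 := fun q' => by
    rw [pairFam, opComm_mul_right, opComm_aStar_aStar, opComm_skew, opComm_aOp_aStar]
    simp only [eq_comm (a := a), eq_comm (a := b)]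
    split_ifs
    · rw [mul_zero, add_zero]
      exact LinearMap.ext fun _ => by simp
    · simp
  refine ((hasOpSum_pairFam hne hl p).opComm_right _).unique ?_
  refine HasOpSum.congr ?_ fun q' => (key q').symm
  split_ifs with h
  · convert HasOpSum.single (-q) _ using 1
    · rw [if_pos ⟨h.1, h.2, by ring⟩, sub_neg_eq_add, add_comm]
    · exact fun q' hq' => if_neg fun h' => hq' (by omega)
  · exact HasOpSum.zero.congr fun q' => (if_neg fun h' => h ⟨h'.1, h'.2.1⟩).symm

theorem opComm_opSum_pairFam_of_commute {a b c d : Fin n} (hne : ¬(a = c ∧ b = d)) (hl : b ≤ d)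
    (p : ℤ) {X : Module.End ℂ (PXY n)} (h1 : ∀ q, Commute X (aOp n r a b q))
    (h2 : ∀ q, Commute X (aStar n r c d q)) : opComm X (opSum (pairFam r a b c d p)) = 0 := by
  refine ((hasOpSum_pairFam hne hl p).opComm_right _).unique ?_
  refine HasOpSum.zero.congr fun q => ?_
  rw [pairFam, opComm_mul_right, opComm_apply, opComm_apply, (h1 q).eq, (h2 _).eq]
  simp

/-- The operator `ρ(F_j)_p`. -/
noncomputable def fOp (r : ℕ) (j : Fin n) (p : ℤ) : Module.End ℂ (PXY n) :=
  aOp n r j j p + ∑ l, if j < l then opSum (pairFam r j l (nxt j) l p) else 0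

theorem opComm_aOp_fOp (k l j : Fin n) (q p : ℤ) :
    opComm (aOp n r k l q) (fOp r j p) =
      if j < l ∧ k = nxt j then aOp n r j l (q + p) else 0 := by
  have key : ∀ l', opComm (aOp n r k l q)
      (if j < l' then opSum (pairFam r j l' (nxt j) l' p) else 0)
      = if l = l' then (if j < l ∧ k = nxt j then aOp n r j l (q + p) else 0) else 0 := fun l' => by
    by_cases h : j < l'
    · rw [if_pos h, opComm_aOp_opSum_pairFam (fun h' => nxt_ne h h'.1) le_rfl]
      split_ifs <;> simp_all
    · rw [if_neg h, map_zero]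
      split_ifs with h1 h2
      · exact absurd (h1 ▸ h2.1) h
      · rfl
      · rfl
  rw [fOp, map_add, map_sum, opComm_aOp_aOp, zero_add, Finset.sum_congr rfl fun l' _ => key l',
    Finset.sum_ite_eq, if_pos (Finset.mem_univ _)]

theorem opComm_aStar_fOp (k l j : Fin n) (q p : ℤ) :
    opComm (aStar n r k l q) (fOp r j p) =
      -(if k = j ∧ l = j ∧ q + p = 0 then 1 else 0) -
        (if k = j ∧ j < l then aStar n r (nxt j) l (q + p) else 0) := by
  have key : ∀ l', opComm (aStar n r k l q)
      (if j < l' then opSum (pairFam r j l' (nxt j) l' p) else 0)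
      = if l = l' then -(if k = j ∧ j < l then aStar n r (nxt j) l (q + p) else 0) else 0 :=
    fun l' => by
    by_cases h : j < l'
    · rw [if_pos h, opComm_aStar_opSum_pairFam (fun h' => nxt_ne h h'.1) le_rfl]
      split_ifs <;> simp_all
    · rw [if_neg h, map_zero]
      split_ifs with h1 h2
      · exact absurd (h1 ▸ h2.2) h
      · exact neg_zero.symm
      · rfl
  rw [fOp, map_add, map_sum, opComm_skew, opComm_aOp_aStar,
    Finset.sum_congr rfl fun l' _ => key l', Finset.sum_ite_eq, if_pos (Finset.mem_univ _),
    ← sub_eq_add_neg]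
  simp only [eq_comm (a := j), add_comm p]

theorem opComm_bOp_fOp (e : Fin n → Fin n → ℂ) (lam : Fin n → ℂ) (i j : Fin n) (q p : ℤ) :
    opComm (bOp n e lam i q) (fOp r j p) = 0 := by
  rw [fOp, map_add, map_sum, opComm_apply, (commute_bOp_aOp ..).eq, sub_self, zero_add]
  refine Finset.sum_eq_zero fun l _ => ?_
  split_ifs with h
  · exact opComm_opSum_pairFam_of_commute (fun h' => nxt_ne h h'.1) le_rfl p
      (fun _ => commute_bOp_aOp ..) fun _ => commute_bOp_aStar ..
  · exact map_zero _

theorem opComm_opSum_cubicFam {i l : Fin n} (hl : l ≤ i) (k j : Fin n) (m p : ℤ) :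
    opComm (opSum (cubicFam r i k k l m)) (fOp r j p) =
      -(if i = j then opSum (normFam r k l (m + p)) else 0) +
        (if j < l ∧ k = nxt j then opSum (cubicFam r i j (nxt j) l (m + p)) else 0) -
        (if k = j ∧ j < l then opSum (cubicFam r i j (nxt j) l (m + p)) else 0) -
        (if k = j ∧ l = j then
          if i = j then opSum (normFam r j j (m + p)) else opSum (pairFam r j j i i (m + p))
        else 0) := by
  have hcomm : ∀ h : j < l, ∀ q : ℤ × ℤ, cubicFam r i j (nxt j) l (m + p) q =
      aStar n r i i q.1 * aOp n r j l q.2 * aStar n r (nxt j) l (m + p - q.1 - q.2) := fun h q => by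
    refine nord3_of_commute (commute_aOp_aStar fun h' => ?_).symm (commute_aStar_aStar ..)
      (commute_aOp_aStar fun h' => nxt_ne h h'.1)
    exact (h.trans_le hl).ne h'.1
  have h1 : HasOpSum (fun q : ℤ × ℤ => nord3
      (if i = j ∧ q.1 + p = 0 then 1 else 0, annSFlag r i q.1)
      (aOp n r k l q.2, annAFlag r l q.2)
      (aStar n r k l (m - q.1 - q.2), annSFlag r l (m - q.1 - q.2)))
      (if i = j then opSum (normFam r k l (m + p)) else 0) := by
    split_ifs with h
    · refine (hasOpSum_normFam k l (m + p)).of_injective (fun q => (-p, q))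
        (fun q q' hq => (Prod.mk.inj hq).2) (fun q => ?_) fun q hq => ?_
      · simp only [h, neg_add_cancel, and_self, if_true, sub_neg_eq_add]
        exact nord3_one_left ..
      · rw [if_neg, nord3_zero_left]
        exact fun h' => hq ⟨q.2, Prod.ext (by simp only; omega) rfl⟩
    · refine HasOpSum.zero.congr fun q => ?_
      rw [if_neg fun h' => h h'.1, nord3_zero_left]
  have h2 : HasOpSum (fun q : ℤ × ℤ => nord3 (aStar n r i i q.1, annSFlag r i q.1)
      (if j < l ∧ k = nxt j then aOp n r j l (q.2 + p) else 0, annAFlag r l q.2)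
      (aStar n r k l (m - q.1 - q.2), annSFlag r l (m - q.1 - q.2)))
      (if j < l ∧ k = nxt j then opSum (cubicFam r i j (nxt j) l (m + p)) else 0) := by
    split_ifs with h
    · refine ((hasOpSum_cubicFam hl j (nxt j) (m + p)).comp_equiv
        ((Equiv.refl ℤ).prodCongr (Equiv.addRight p))).congr fun q => ?_
      rw [hcomm h.1, nord3_of_commute (commute_aOp_aStar fun h' => (h.1.trans_le hl).ne h'.1).symm
        (commute_aStar_aStar ..) (commute_aOp_aStar fun h' => nxt_ne h.1 (h'.1.trans h.2)), h.2]
      simp only [Equiv.prodCongr_apply, Prod.map, Equiv.refl_apply, Equiv.coe_addRight]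
      congr 2
      ring
    · exact HasOpSum.zero.congr fun q => nord3_zero_mid.symm
  have h3 : HasOpSum (fun q : ℤ × ℤ => nord3 (aStar n r i i q.1, annSFlag r i q.1)
      (aOp n r k l q.2, annAFlag r l q.2)
      (if k = j ∧ j < l then aStar n r (nxt j) l (m - q.1 - q.2 + p) else 0,
        annSFlag r l (m - q.1 - q.2)))
      (if k = j ∧ j < l then opSum (cubicFam r i j (nxt j) l (m + p)) else 0) := by
    split_ifs with h
    · refine (hasOpSum_cubicFam hl j (nxt j) (m + p)).congr fun q => ?_
      rw [hcomm h.2, h.1, nord3_of_commute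
        (commute_aOp_aStar fun h' => (h.2.trans_le hl).ne h'.1).symm
        (commute_aStar_aStar ..) (commute_aOp_aStar fun h' => nxt_ne h.2 h'.1)]
      congr 2
      ring
    · exact HasOpSum.zero.congr fun q => nord3_zero_right.symm
  have h4 : HasOpSum (fun q : ℤ × ℤ => nord3 (aStar n r i i q.1, annSFlag r i q.1)
      (aOp n r k l q.2, annAFlag r l q.2)
      (if k = j ∧ l = j ∧ m - q.1 - q.2 + p = 0 then 1 else 0, annSFlag r l (m - q.1 - q.2)))
      (if k = j ∧ l = j then
          if i = j then opSum (normFam r j j (m + p)) else opSum (pairFam r j j i i (m + p))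
        else 0) := by
    have hinj : Function.Injective fun q : ℤ => (m + p - q, q) :=
      fun q q' hq => (Prod.mk.inj hq).2
    have hran : ∀ q : ℤ × ℤ, q ∉ Set.range (fun q : ℤ => (m + p - q, q)) →
        nord3 (aStar n r i i q.1, annSFlag r i q.1) (aOp n r k l q.2, annAFlag r l q.2)
          (if k = j ∧ l = j ∧ m - q.1 - q.2 + p = 0 then 1 else 0,
            annSFlag r l (m - q.1 - q.2)) = 0 := fun q hq => by
      rw [if_neg, nord3_zero_right]
      exact fun h' => hq ⟨q.2, Prod.ext (by simp only; omega) rfl⟩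
    have hval : ∀ q : ℤ, m - (m + p - q) - q + p = 0 := fun q => by ring
    split_ifs with h hij
    · refine (hasOpSum_normFam j j (m + p)).of_injective _ hinj (fun q => ?_) hran
      simp only [h, hij, hval, and_self, if_true]
      exact nord3_one_right ..
    · refine (hasOpSum_pairFam (fun h' => hij h'.1.symm) (h.2 ▸ hl) (m + p)).of_injective _ hinj
        (fun q => ?_) hran
      simp only [h, hval, and_self, if_true]
      have hc : Commute (aOp n r j j q) (aStar n r i i (m + p - q)) :=
        commute_aOp_aStar fun h' => hij h'.1.symm
      rw [nord3_of_commute hc.symm (Commute.one_right _) (Commute.one_right _), mul_one, pairFam,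
        hc.eq]
    · refine HasOpSum.zero.congr fun q => ?_
      rw [if_neg fun h' => h ⟨h'.1, h'.2.1⟩, nord3_zero_right]
  refine ((hasOpSum_cubicFam hl k k m).opComm_left _).unique ?_
  refine (((h1.neg.add h2).sub h3).sub h4).congr fun q => ?_
  have e1 : opComm (aStar n r i i q.1) (fOp r j p) = -(if i = j ∧ q.1 + p = 0 then 1 else 0) := by
    rw [opComm_aStar_fOp]
    split_ifs <;> first | omega | simp
  rw [cubicFam, opComm_nord3, e1, opComm_aOp_fOp, opComm_aStar_fOp, nord3_neg_left,
    nord3_neg_sub_right]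
  abel

theorem opComm_opSum_pairFam_low {k i : Fin n} (hk : k < i) (j : Fin n) (m p : ℤ) :
    opComm (opSum (pairFam r k (prv i) k i m)) (fOp r j p) =
      (if j < prv i ∧ k = nxt j then opSum (pairFam r j (prv i) (nxt j) i (m + p)) else 0) -
        (if k = j ∧ j < i then opSum (pairFam r j (prv i) (nxt j) i (m + p)) else 0) := by
  have hi : prv i < i := by
    rw [Fin.lt_def] at hk ⊢
    rw [prv_val]
    omega
  have h1 : HasOpSum (fun q : ℤ =>
      (if j < prv i ∧ k = nxt j then aOp n r j (prv i) (q + p) else 0) *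
      aStar n r k i (m - q))
      (if j < prv i ∧ k = nxt j then opSum (pairFam r j (prv i) (nxt j) i (m + p)) else 0) := by
    split_ifs with h
    · refine ((hasOpSum_pairFam (fun h' => nxt_ne h.1 h'.1) hi.le (m + p)).comp_equiv
        (Equiv.addRight p)).congr fun q => ?_
      rw [pairFam, h.2, Equiv.coe_addRight]
      congr 2
      ring
    · exact HasOpSum.zero.congr fun q => (zero_mul _).symm
  have h2 : HasOpSum (fun q : ℤ => aOp n r k (prv i) q *
      (if k = j ∧ j < i then aStar n r (nxt j) i (m - q + p) else 0))
      (if k = j ∧ j < i then opSum (pairFam r j (prv i) (nxt j) i (m + p)) else 0) := by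
    split_ifs with h
    · refine (hasOpSum_pairFam (fun h' => nxt_ne h.2 h'.1) hi.le (m + p)).congr fun q => ?_
      rw [pairFam, h.1]
      congr 2
      ring
    · exact HasOpSum.zero.congr fun q => (mul_zero _).symm
  refine ((hasOpSum_pairFam (fun h => hi.ne h.2) hi.le m).opComm_left _).unique ?_
  refine (h1.sub h2).congr fun q => ?_
  rw [pairFam, opComm_mul_left, opComm_aOp_fOp, opComm_aStar_fOp, if_neg (c := k = j ∧ i = j ∧ _)
    (fun h => hk.ne (h.1.trans h.2.1.symm)), neg_zero, zero_sub]
  exact LinearMap.ext fun _ => by split_ifs <;> simp [sub_eq_add_neg]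

theorem pairFam_self (k l : Fin n) (s q : ℤ) : pairFam r k l k l s q =
    normFam r k l s q + if 0 ≤ q ∧ (l : ℕ) + 1 ≤ r ∧ s = 0 then 1 else 0 := by
  have h := opComm_aOp_aStar (r := r) k l k l q (s - q)
  simp only [true_and, add_sub_cancel] at h
  rw [pairFam, normFam]
  split_ifs with h1 h2 h2
  · rw [if_pos h2.2.2, opComm_apply] at h
    exact sub_eq_iff_eq_add'.1 h
  · rw [if_neg fun h' => h2 ⟨h1.1, h1.2, h'⟩, opComm_apply] at h
    exact sub_eq_iff_eq_add'.1 h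
  · exact absurd ⟨h2.1, h2.2.1⟩ h1
  · exact (add_zero _).symm

theorem hasOpSum_shift_step (p : ℤ) : HasOpSum (fun q : ℤ => ((if 0 ≤ q + p then 1 else 0) -
    (if 0 ≤ q then 1 else 0) : Module.End ℂ (PXY n))) ((p : ℂ) • 1) := by
  intro P
  have hs : (Function.support fun q : ℤ => ((if 0 ≤ q + p then 1 else 0) -
      (if 0 ≤ q then 1 else 0) : Module.End ℂ (PXY n)) P) ⊆
      ((Finset.Ico (-p) 0 ∪ Finset.Ico 0 (-p) : Finset ℤ) : Set ℤ) := fun q hq => by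
    by_contra h
    simp only [Finset.coe_union, Finset.coe_Ico, Set.mem_union, Set.mem_Ico] at h
    refine hq ?_
    by_cases h0 : 0 ≤ q
    · simp [h0, show 0 ≤ q + p by omega]
    · simp [h0, show ¬ 0 ≤ q + p by omega]
  refine ⟨(Finset.finite_toSet _).subset hs, ?_⟩
  rw [finsum_eq_sum_of_support_subset _ hs]
  obtain h | h := le_total 0 p
  · rw [Finset.Ico_eq_empty_of_le (a := (0 : ℤ)) (by omega), Finset.union_empty,
      Finset.sum_congr rfl (g := fun _ => P) fun q hq => ?_]
    · simp only [Finset.sum_const, Int.card_Ico, sub_neg_eq_add, zero_add]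
      rw [← Nat.cast_smul_eq_nsmul ℂ]
      simp only [LinearMap.smul_apply, Module.End.one_apply]
      congr 1
      exact_mod_cast congrArg (Int.cast : ℤ → ℂ) (Int.toNat_of_nonneg h)
    · rw [Finset.mem_Ico] at hq
      simp [show 0 ≤ q + p by omega, show ¬ 0 ≤ q by omega]
  · rw [Finset.Ico_eq_empty_of_le (b := (0 : ℤ)) (by omega), Finset.empty_union,
      Finset.sum_congr rfl (g := fun _ => -P) fun q hq => ?_]
    · simp only [Finset.sum_const, Int.card_Ico, sub_zero]
      rw [← Nat.cast_smul_eq_nsmul ℂ]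
      simp only [LinearMap.smul_apply, Module.End.one_apply, smul_neg, ← neg_smul]
      congr 1
      have := congrArg (Int.cast : ℤ → ℂ) (Int.toNat_of_nonneg (neg_nonneg.2 h))
      push_cast at this
      rw [this, neg_neg]
    · rw [Finset.mem_Ico] at hq
      simp [show ¬ 0 ≤ q + p by omega, show 0 ≤ q by omega]

theorem opComm_opSum_pairFam_high {i k : Fin n} (hk : i < k) (j : Fin n) (m p : ℤ) :
    opComm (opSum (pairFam r (nxt i) k i k m)) (fOp r j p) =
      if i = j then
        opSum (normFam r i k (m + p)) - opSum (normFam r (nxt i) k (m + p)) -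
          (if (k : ℕ) + 1 ≤ r ∧ m + p = 0 then (m : ℂ) else 0) • 1
      else 0 := by
  refine ((hasOpSum_pairFam (fun h => nxt_ne hk h.1.symm) le_rfl m).opComm_left _).unique ?_
  have key : ∀ q, opComm (pairFam r (nxt i) k i k m q) (fOp r j p) =
      if i = j then pairFam r i k i k (m + p) (q + p) - pairFam r (nxt i) k (nxt i) k (m + p) q
      else 0 := fun q => by
    rw [pairFam, opComm_mul_left, opComm_aOp_fOp, opComm_aStar_fOp,
      if_neg (c := i = j ∧ k = j ∧ _) (fun h => hk.ne (h.1.trans h.2.1.symm)), neg_zero, zero_sub]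
    by_cases h : i = j
    · subst h
      rw [if_pos ⟨hk, rfl⟩, if_pos ⟨rfl, hk⟩, if_pos rfl, pairFam, pairFam,
        add_sub_add_right_eq_sub, sub_add_eq_add_sub]
      exact LinearMap.ext fun _ => by simp [sub_eq_add_neg]
    · have h' : ¬(j < k ∧ nxt i = nxt j) := fun h' => by
        have := congrArg Fin.val h'.2
        rw [nxt_val hk, nxt_val h'.1] at this
        exact h (Fin.ext (by omega))
      rw [if_neg h', if_neg fun h' => h h'.1, if_neg h]
      exact LinearMap.ext fun _ => by simp
  refine HasOpSum.congr ?_ fun q => (key q).symm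
  split_ifs with h h' 
  · have h1 := ((hasOpSum_normFam (r := r) i k (m + p)).comp_equiv (Equiv.addRight p)).sub
      (hasOpSum_normFam (r := r) (nxt i) k (m + p))
    have hm : ((p : ℂ) • 1 : Module.End ℂ (PXY n)) = -((m : ℂ) • 1) := by
      rw [show p = -m by omega]
      exact LinearMap.ext fun _ => by simp
    have h2 := h1.add (hasOpSum_shift_step p)
    rw [hm, ← sub_eq_add_neg] at h2
    refine h2.congr fun q => ?_
    rw [pairFam_self, pairFam_self]
    simp only [h'.1, h'.2, and_true, Equiv.coe_addRight]
    abel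
  · have h1 := ((hasOpSum_normFam (r := r) i k (m + p)).comp_equiv (Equiv.addRight p)).sub
      (hasOpSum_normFam (r := r) (nxt i) k (m + p))
    rw [zero_smul, sub_zero]
    refine h1.congr fun q => ?_
    rw [pairFam_self, pairFam_self]
    rw [if_neg fun h => h' h.2, if_neg fun h => h' h.2, add_zero, add_zero, Equiv.coe_addRight]
  · exact HasOpSum.zero

theorem opComm_opSum_aStar_mul_bOp (e : Fin n → Fin n → ℂ) (lam : Fin n → ℂ) (i j : Fin n)
    (m p : ℤ) :
    opComm (opSum fun q => aStar n r i i q * bOp n e lam i (m - q)) (fOp r j p) =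
      -(if i = j then bOp n e lam i (m + p) else 0) := by
  have key : ∀ q, opComm (aStar n r i i q * bOp n e lam i (m - q)) (fOp r j p) =
      -(if i = j ∧ q + p = 0 then bOp n e lam i (m - q) else 0) := fun q => by
    rw [opComm_mul_left, opComm_bOp_fOp, mul_zero, add_zero, opComm_aStar_fOp,
      if_neg (c := i = j ∧ j < i) (fun h => h.2.ne h.1.symm), sub_zero]
    refine LinearMap.ext fun _ => ?_
    split_ifs <;> first | omega | simp
  refine ((hasOpSum_aStar_mul_bOp e lam i m).opComm_left _).unique ?_
  refine HasOpSum.congr (HasOpSum.neg ?_) fun q => (key q).symm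
  split_ifs with h
  · convert HasOpSum.single (-p) _ using 1
    · rw [if_pos ⟨h, by ring⟩, sub_neg_eq_add]
    · exact fun q hq => if_neg fun h' => hq (by omega)
  · exact HasOpSum.zero.congr fun q => (if_neg fun h' => h h'.1).symm

theorem pairRoot_eq {k l : Fin n} (h : k ≤ l) (i : Fin n) : pairRoot n i k l =
    (if k = i then 1 else 0) + (if l = i then 1 else 0) -
      (if (k : ℕ) = (i : ℕ) + 1 then 1 else 0) - (if (l : ℕ) + 1 = (i : ℕ) then 1 else 0) := by
  let g : ℕ → ℤ := fun s => (if s = (i : ℕ) + 1 then 1 else 0) - if s = (i : ℕ) then 1 else 0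
  have hg : ∀ s : Fin n, cartan n i s = g (s + 1) - g s := fun s => by
    simp only [cartan, g, Fin.ext_iff]
    split_ifs <;> omega
  have hs : pairRoot n i k l = ∑ s ∈ Finset.Ico (k : ℕ) ((l : ℕ) + 1), (g (s + 1) - g s) := by
    have hI : Finset.Ico (k : ℕ) ((l : ℕ) + 1) = (Finset.Icc k l).map Fin.valEmbedding := by
      rw [Fin.map_valEmbedding_Icc]
      rfl
    rw [hI, Finset.sum_map]
    exact Finset.sum_congr rfl fun s _ => hg s
  rw [Fin.le_def] at h
  rw [hs, Finset.sum_Ico_sub g (by omega)]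
  simp only [g, Fin.ext_iff]
  split_ifs <;> omega

theorem sum_pairRoot_smul {V : Type*} [AddCommGroup V] [Module ℂ V] (i : Fin n)
    (N : Fin n → Fin n → V) :
    (∑ k, ∑ l, if k ≤ l then (pairRoot n i k l : ℂ) • N k l else 0) =
      (∑ k, if k ≤ i then N k i else 0) + N i i - (∑ k, if k < i then N k (prv i) else 0) +
        ∑ k, if i < k then N i k - N (nxt i) k else 0 := by
  have key : ∀ k l, (if k ≤ l then (pairRoot n i k l : ℂ) • N k l else 0) =
      (if i = k then if i ≤ l then N i l else 0 else 0) +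
        (if i = l then if k ≤ i then N k i else 0 else 0) -
        (if nxt i = k then if i < l then N (nxt i) l else 0 else 0) -
        (if prv i = l then if k < i then N k (prv i) else 0 else 0) := fun k l => by
    have hp := prv_val i
    have hn := @nxt_val n i l
    by_cases h : k ≤ l
    · rw [if_pos h, pairRoot_eq h]
      push_cast
      simp only [add_smul, sub_smul, ite_smul, one_smul, zero_smul]
      congr 1
      congr 1
      congr 1
      · by_cases h1 : i = k
        · subst h1; simp [h]
        · simp [h1, Ne.symm h1]
      · by_cases h1 : i = l
        · subst h1; simp [h]
        · simp [h1, Ne.symm h1]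
      · by_cases h1 : nxt i = k
        · subst h1
          rw [if_pos rfl]
          by_cases h2 : i < l
          · rw [if_pos (hn h2), if_pos h2]
          · rw [if_neg h2, if_neg]
            intro h3
            rw [Fin.le_def] at h
            rw [Fin.lt_def] at h2
            omega
        · rw [if_neg h1, if_neg]
          intro h3
          rw [Fin.le_def] at h
          exact h1 (Fin.ext ((hn (Fin.lt_def.2 (by omega))).trans h3.symm))
      · by_cases h1 : prv i = l
        · subst h1
          rw [if_pos rfl]
          refine if_congr ?_ rfl rfl
          rw [Fin.le_def] at h
          rw [Fin.lt_def]
          omega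
        · rw [if_neg h1, if_neg fun h2 => h1 (Fin.ext (by omega))]
    · rw [if_neg h]
      rw [Fin.le_def, not_le] at h
      rw [ite_eq_right_iff.2 fun h1 => if_neg fun h2 => ?_,
        ite_eq_right_iff.2 fun h1 => if_neg fun h2 => ?_,
        ite_eq_right_iff.2 fun h1 => if_neg fun h2 => ?_,
        ite_eq_right_iff.2 fun h1 => if_neg fun h2 => ?_]
      · simp
      · subst h1; rw [Fin.lt_def] at h2; omega
      · subst h1; rw [hn h2] at h; rw [Fin.lt_def] at h2; omega
      · subst h1; rw [Fin.le_def] at h2; omega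
      · subst h1; rw [Fin.le_def] at h2; omega
  simp only [key, Finset.sum_sub_distrib, Finset.sum_add_distrib]
  rw [Finset.sum_comm (f := fun k l => if i = k then if i ≤ l then N i l else 0 else 0),
    Finset.sum_comm (f := fun k l => if nxt i = k then if i < l then N (nxt i) l else 0 else 0)]
  simp only [Finset.sum_ite_eq, Finset.mem_univ, if_true]
  have h1 : ∀ k, (if i ≤ k then N i k else 0) =
      (if i = k then N i i else 0) + if i < k then N i k else 0 := fun k => by
    obtain h | h | h := lt_trichotomy i k
    · simp [h, h.le, h.ne]
    · simp [h]
    · simp [h.not_ge, h.not_gt, h.ne']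
  have h2 : ∀ k, (if i < k then N i k - N (nxt i) k else 0) =
      (if i < k then N i k else 0) - if i < k then N (nxt i) k else 0 := fun k => by
    split_ifs <;> simp
  simp only [h1, h2, Finset.sum_sub_distrib, Finset.sum_add_distrib, Finset.sum_ite_eq,
    Finset.mem_univ, if_true]
  abel

theorem sum_high_const {m p : ℤ} (hr : r ≤ n) (i : Fin n) :
    (∑ k : Fin n, if i < k then (if (k : ℕ) + 1 ≤ r ∧ m + p = 0 then (m : ℂ) else 0) else 0) =
      if (i : ℕ) + 1 ≤ r then ((r : ℂ) - ((i : ℂ) + 1)) * m * (if m + p = 0 then 1 else 0)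
      else 0 := by
  have h1 : ∀ k : Fin n, (if i < k then (if (k : ℕ) + 1 ≤ r ∧ m + p = 0 then (m : ℂ) else 0) else 0)
      = if (i : ℕ) + 1 ≤ k ∧ (k : ℕ) < r then (m : ℂ) * (if m + p = 0 then 1 else 0) else 0 :=
    fun k => by
    simp only [Fin.lt_def, Nat.succ_le_iff]
    split_ifs <;> first | omega | simp
  rw [Finset.sum_congr rfl fun k _ => h1 k, Fin.sum_univ_eq_sum_range
    (fun k => if (i : ℕ) + 1 ≤ k ∧ k < r then (m : ℂ) * (if m + p = 0 then 1 else 0) else 0),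
    ← Finset.sum_filter]
  have h2 : (Finset.range n).filter (fun k => (i : ℕ) + 1 ≤ k ∧ k < r) =
      Finset.Ico ((i : ℕ) + 1) r := by
    ext k
    simp only [Finset.mem_filter, Finset.mem_range, Finset.mem_Ico]
    omega
  rw [h2, Finset.sum_const, Nat.card_Ico, nsmul_eq_mul]
  by_cases h3 : (i : ℕ) + 1 ≤ r
  · rw [if_pos h3, Nat.cast_sub h3]
    push_cast
    ring
  · rw [if_neg h3, Nat.sub_eq_zero_of_le (not_le.1 h3).le, Nat.cast_zero, zero_mul]

/-- The operator `ρ(E_i)_m`. -/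
noncomputable def eOp (r : ℕ) (γ : ℂ) (e : Fin n → Fin n → ℂ) (lam : Fin n → ℂ) (i : Fin n)
    (m : ℤ) : Module.End ℂ (PXY n) :=
  (∑ k, if k < i then opSum (cubicFam r i k k (prv i) m) else 0) -
    (∑ k, if k ≤ i then opSum (cubicFam r i k k i m) else 0) +
    (∑ k, if i < k then opSum (pairFam r (nxt i) k i k m) else 0) -
    (∑ k, if k < i then opSum (pairFam r k (prv i) k i m) else 0) -
    (opSum fun q => aStar n r i i q * bOp n e lam i (m - q)) -
    ((if r < (i : ℕ) + 1 then (r : ℂ) + 1 else 0)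
      + (if (i : ℕ) + 1 ≤ r then ((i : ℕ) : ℂ) + 2 else 0) - γ ^ 2) •
      ((-(m : ℂ)) • aStar n r i i m)

theorem opSum_pairFam_apply {k l k' l' : Fin n} (hne : ¬(k = k' ∧ l = l')) (hl : l ≤ l') (m : ℤ)
    (P : PXY n) : opSum (pairFam r k l k' l' m) P = pairOp n r k l k' l' m P :=
  (hasOpSum_pairFam hne hl m P).2.symm

theorem opSum_normFam_apply (k l : Fin n) (m : ℤ) (P : PXY n) :
    opSum (normFam r k l m) P = Nop n r k l m P := by
  rw [← (hasOpSum_normFam k l m P).2, Nop]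
  refine finsum_congr fun q => ?_
  rw [normFam]
  split_ifs <;> rfl

theorem prv_le (i : Fin n) : prv i ≤ i := by
  rw [Fin.le_def, prv_val]
  omega

theorem fOp_apply (j : Fin n) (p : ℤ) (P : PXY n) : fOp r j p P = rhoF n r j p P := by
  rw [fOp, rhoF, sumF, LinearMap.add_apply, LinearMap.sum_apply]
  congr 1
  refine Finset.sum_congr rfl fun l _ => ?_
  split_ifs with h
  · rw [opSum_pairFam_apply (fun h' => nxt_ne h h'.1) le_rfl]
    congr
    exact Fin.ext (nxt_val h)
  · rfl

theorem eOp_apply (γ : ℂ) (e : Fin n → Fin n → ℂ) (lam : Fin n → ℂ) (i : Fin n) (m : ℤ)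
    (P : PXY n) : eOp r γ e lam i m P = rhoE n r γ e lam i m P := by
  have hc : ∀ k l, l ≤ i → opSum (cubicFam r i k k l m) P = cubic n r i k l m P :=
    fun k l hl => (hasOpSum_cubicFam hl k k m P).2.symm
  simp only [eOp, rhoE, sumHigh, sumLow, LinearMap.add_apply, LinearMap.sub_apply,
    LinearMap.sum_apply, LinearMap.smul_apply]
  congr 1
  congr 1
  · congr 1
    · congr 1
      · congr 1
        · refine Finset.sum_congr rfl fun k _ => ?_
          split_ifs with h
          · exact hc k _ (prv_le i)
          · rfl
        · refine Finset.sum_congr rfl fun k _ => ?_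
          split_ifs with h
          · exact hc k _ le_rfl
          · rfl
      · refine Finset.sum_congr rfl fun k _ => ?_
        split_ifs with h
        · rw [opSum_pairFam_apply (fun h' => nxt_ne h h'.1.symm) le_rfl]
          congr
          exact Fin.ext (nxt_val h)
        · rfl
    · refine Finset.sum_congr rfl fun k _ => ?_
      split_ifs with h
      · refine opSum_pairFam_apply (fun h' => ?_) (prv_le i) m P
        have := congrArg Fin.val h'.2
        rw [prv_val] at this
        rw [Fin.lt_def] at h
        omega
      · rfl
  · exact (hasOpSum_aStar_mul_bOp e lam i m P).2.symm

theorem lt_prv_iff {i j : Fin n} : j < prv i ↔ j < i ∧ nxt j < i := by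
  constructor
  · intro h
    have h1 := nxt_val h
    rw [Fin.lt_def] at h ⊢
    rw [Fin.lt_def, h1]
    rw [prv_val] at h
    omega
  · rintro ⟨h, h'⟩
    rw [Fin.lt_def, nxt_val h] at h'
    rw [Fin.lt_def, prv_val]
    omega

theorem sum_opComm_cubic_low (i j : Fin n) (m p : ℤ) :
    opComm (∑ k, if k < i then opSum (cubicFam r i k k (prv i) m) else 0) (fOp r j p) =
      -(if i = j then ∑ k, (if k < i then opSum (normFam r k (prv i) (m + p)) else 0) else 0) -
        (if (i : ℕ) = (j : ℕ) + 1 then opSum (pairFam r j j i i (m + p)) else 0) := by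
  set T := opSum (cubicFam r i j (nxt j) (prv i) (m + p))
  have key : ∀ k, opComm (if k < i then opSum (cubicFam r i k k (prv i) m) else 0) (fOp r j p) =
      -(if i = j then (if k < i then opSum (normFam r k (prv i) (m + p)) else 0) else 0) +
        (if nxt j = k then (if j < prv i then T else 0) else 0) -
        (if j = k then (if j < prv i then T else 0) else 0) -
        (if j = k then
          if (i : ℕ) = (j : ℕ) + 1 then opSum (pairFam r j j i i (m + p)) else 0 else 0) :=
    fun k => by
    by_cases hk : k < i
    · rw [if_pos hk, opComm_opSum_cubicFam (prv_le i), if_pos hk]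
      congr 1
      · congr 1
        · congr 1
          rw [← ite_and]
          exact if_congr (and_comm.trans (and_congr_left' eq_comm)) rfl rfl
        · rw [← ite_and]
          exact if_congr (and_congr_left' eq_comm) rfl rfl
      · by_cases h : j = k
        · subst h
          have h1 : prv i = j ↔ (i : ℕ) = (j : ℕ) + 1 := by
            rw [Fin.ext_iff, prv_val]
            rw [Fin.lt_def] at hk
            omega
          simp only [true_and, if_true, h1, if_neg hk.ne']
        · rw [if_neg h, if_neg fun h' => h h'.1.symm]
    · have h1 : ¬(nxt j = k ∧ j < prv i) := fun h => hk (h.1 ▸ (lt_prv_iff.1 h.2).2)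
      have h2 : ¬(j = k ∧ j < prv i) := fun h => hk (h.1 ▸ (lt_prv_iff.1 h.2).1)
      have h3 : ¬(j = k ∧ (i : ℕ) = (j : ℕ) + 1) := fun h => hk (by
        rw [Fin.lt_def, ← h.1]
        omega)
      simp only [← ite_and, if_neg h1, if_neg h2, if_neg h3, if_neg hk]
      simp
  rw [map_sum, LinearMap.sum_apply, Finset.sum_congr rfl fun k _ => key k]
  simp only [Finset.sum_sub_distrib, Finset.sum_add_distrib, Finset.sum_ite_eq, Finset.mem_univ,
    if_true, Finset.sum_neg_distrib]
  rw [add_sub_cancel_right]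
  split_ifs <;> simp

theorem sum_opComm_cubic (i j : Fin n) (m p : ℤ) :
    opComm (∑ k, if k ≤ i then opSum (cubicFam r i k k i m) else 0) (fOp r j p) =
      -(if i = j then (∑ k, if k ≤ i then opSum (normFam r k i (m + p)) else 0) +
        opSum (normFam r i i (m + p)) else 0) := by
  set T := opSum (cubicFam r i j (nxt j) i (m + p))
  have key : ∀ k, opComm (if k ≤ i then opSum (cubicFam r i k k i m) else 0) (fOp r j p) =
      -(if i = j then (if k ≤ i then opSum (normFam r k i (m + p)) else 0) else 0) +
        (if nxt j = k then (if j < i then T else 0) else 0) -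
        (if j = k then (if j < i then T else 0) else 0) -
        (if j = k then if i = j then opSum (normFam r i i (m + p)) else 0 else 0) :=
    fun k => by
    by_cases hk : k ≤ i
    · rw [if_pos hk, opComm_opSum_cubicFam le_rfl, if_pos hk]
      congr 1
      · congr 1
        · congr 1
          rw [← ite_and]
          exact if_congr (and_comm.trans (and_congr_left' eq_comm)) rfl rfl
        · rw [← ite_and]
          exact if_congr (and_congr_left' eq_comm) rfl rfl
      · by_cases h : j = k
        · subst h
          by_cases hij : i = j
          · subst hij
            simp
          · simp [hij]
        · rw [if_neg h, if_neg fun h' => h h'.1.symm]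
    · have h1 : ¬(nxt j = k ∧ j < i) := fun h => hk (by
        rw [← h.1, Fin.le_def, nxt_val h.2]
        exact h.2)
      have h2 : ¬(j = k ∧ j < i) := fun h => hk (h.1 ▸ h.2.le)
      have h3 : ¬(j = k ∧ i = j) := fun h => hk (h.1 ▸ h.2.ge)
      simp only [← ite_and, if_neg h1, if_neg h2, if_neg h3, if_neg hk]
      simp
  rw [map_sum, LinearMap.sum_apply, Finset.sum_congr rfl fun k _ => key k]
  simp only [Finset.sum_sub_distrib, Finset.sum_add_distrib, Finset.sum_ite_eq, Finset.mem_univ,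
    if_true, Finset.sum_neg_distrib]
  rw [add_sub_cancel_right]
  refine LinearMap.ext fun P => ?_
  split_ifs
  · simp
    abel
  · simp

theorem sum_opComm_high (hr : r ≤ n) (i j : Fin n) (m p : ℤ) :
    opComm (∑ k, if i < k then opSum (pairFam r (nxt i) k i k m) else 0) (fOp r j p) =
      if i = j then
        (∑ k, if i < k then opSum (normFam r i k (m + p)) - opSum (normFam r (nxt i) k (m + p))
          else 0) -
        (if (i : ℕ) + 1 ≤ r then ((r : ℂ) - ((i : ℂ) + 1)) * m * (if m + p = 0 then 1 else 0)
          else 0) • 1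
      else 0 := by
  rw [map_sum, LinearMap.sum_apply]
  by_cases hij : i = j
  · rw [if_pos hij, ← sum_high_const hr, Finset.sum_smul, ← Finset.sum_sub_distrib]
    refine Finset.sum_congr rfl fun k _ => ?_
    by_cases hk : i < k
    · rw [if_pos hk, if_pos hk, if_pos hk, opComm_opSum_pairFam_high hk, if_pos hij]
    · simp [hk]
  · rw [if_neg hij]
    refine Finset.sum_eq_zero fun k _ => ?_
    by_cases hk : i < k
    · rw [if_pos hk, opComm_opSum_pairFam_high hk, if_neg hij]
    · simp [hk]

theorem sum_opComm_low (i j : Fin n) (m p : ℤ) :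
    opComm (∑ k, if k < i then opSum (pairFam r k (prv i) k i m) else 0) (fOp r j p) =
      -(if (i : ℕ) = (j : ℕ) + 1 then opSum (pairFam r j j i i (m + p)) else 0) := by
  set G := opSum (pairFam r j (prv i) (nxt j) i (m + p)) with hG
  have key : ∀ k, opComm (if k < i then opSum (pairFam r k (prv i) k i m) else 0) (fOp r j p) =
      (if nxt j = k then (if j < prv i then G else 0) else 0) -
        (if j = k then (if j < i then G else 0) else 0) := fun k => by
    simp only [← ite_and]
    by_cases hk : k < i
    · rw [if_pos hk, opComm_opSum_pairFam_low hk]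
      congr 1
      · exact if_congr (and_comm.trans (and_congr_left' eq_comm)) rfl rfl
      · exact if_congr (and_congr_left' eq_comm) rfl rfl
    · have h1 : ¬(nxt j = k ∧ j < prv i) := fun h => hk (h.1 ▸ (lt_prv_iff.1 h.2).2)
      have h2 : ¬(j = k ∧ j < i) := fun h => hk (h.1 ▸ h.2)
      rw [if_neg hk, if_neg h1, if_neg h2]
      simp
  rw [map_sum, LinearMap.sum_apply, Finset.sum_congr rfl fun k _ => key k]
  simp only [Finset.sum_sub_distrib, Finset.sum_ite_eq, Finset.mem_univ, if_true]
  by_cases h1 : j < prv i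
  · have h2 := lt_prv_iff.1 h1
    rw [if_pos h1, if_pos h2.1, if_neg, sub_self, neg_zero]
    rw [Fin.lt_def, prv_val] at h1
    omega
  · rw [if_neg h1, zero_sub]
    congr 1
    rw [Fin.lt_def, prv_val] at h1
    by_cases h2 : j < i
    · have h3 : (i : ℕ) = (j : ℕ) + 1 := by
        rw [Fin.lt_def] at h2
        omega
      rw [if_pos h2, if_pos h3, hG, show prv i = j from Fin.ext (by rw [prv_val]; omega),
        show nxt j = i from Fin.ext ((nxt_val h2).trans h3.symm)]
    · rw [if_neg h2, if_neg]
      rw [Fin.lt_def] at h2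
      omega

theorem opComm_eOp_fOp (hr : r ≤ n) (γ : ℂ) (e : Fin n → Fin n → ℂ) (lam : Fin n → ℂ)
    (i j : Fin n) (m p : ℤ) : opComm (eOp r γ e lam i m) (fOp r j p) =
      if i = j then
        (∑ k, ∑ l, if k ≤ l then (pairRoot n i k l : ℂ) • opSum (normFam r k l (m + p)) else 0) +
          bOp n e lam i (m + p) +
          ((γ ^ 2 - ((r : ℂ) + 1)) * (m : ℂ) * (if m + p = 0 then 1 else 0)) • 1
      else 0 := by
  rw [eOp, map_sub, map_sub, map_sub, map_add, map_sub]
  simp only [LinearMap.sub_apply, LinearMap.add_apply, map_smul, LinearMap.smul_apply]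
  rw [sum_opComm_cubic_low, sum_opComm_cubic, sum_opComm_high hr, sum_opComm_low,
    opComm_opSum_aStar_mul_bOp, opComm_aStar_fOp,
    if_neg (c := i = j ∧ j < i) (fun h => h.2.ne h.1.symm), sub_zero]
  by_cases hij : i = j
  · subst hij
    rw [if_pos rfl, if_pos rfl, if_pos rfl, if_pos rfl, if_pos rfl, if_neg (by omega),
      sum_pairRoot_smul i fun k l => opSum (normFam r k l (m + p))]
    simp only [true_and]
    refine LinearMap.ext fun P => ?_
    have hc : ((γ ^ 2 - ((r : ℂ) + 1)) * (m : ℂ) * (if m + p = 0 then 1 else 0)) • P =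
        -((if (i : ℕ) + 1 ≤ r then ((r : ℂ) - ((i : ℂ) + 1)) * m * (if m + p = 0 then 1 else 0)
          else 0) • P) -
        ((if r < (i : ℕ) + 1 then (r : ℂ) + 1 else 0)
          + (if (i : ℕ) + 1 ≤ r then ((i : ℕ) : ℂ) + 2 else 0) - γ ^ 2) •
          ((-(m : ℂ)) • -(if m + p = 0 then P else 0)) := by
      split_ifs <;> first | omega | module
    have hone : (if m + p = 0 then (1 : Module.End ℂ (PXY n)) else 0) P =
        if m + p = 0 then P else 0 := by
      split_ifs <;> rfl
    simp only [LinearMap.add_apply, LinearMap.sub_apply, LinearMap.neg_apply,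
      LinearMap.smul_apply, Module.End.one_apply, LinearMap.zero_apply, hone, hc]
    abel
  · simp only [if_neg hij]
    refine LinearMap.ext fun P => ?_
    simp [hij]

end Realization

/-- R4:
`[ρ(E_i)_m, ρ(F_j)_p] = δ_{ij}(ρ(H_i)_{m+p} + (γ²−(r+1)) m δ_{m+p,0} id)`. -/
theorem wakimoto_R4 (n r : ℕ) (hn : 1 ≤ n) (hr : r ≤ n)
    (γ : ℂ) (hγ : γ ≠ 0) (e : Fin n → Fin n → ℂ) (lam : Fin n → ℂ)
    (he : ∀ i j, ∑ k, e i k * e j k = Bmat n r γ i j)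
    (i j : Fin n) (m p : ℤ) (P : PXY n) :
    rhoE n r γ e lam i m (rhoF n r j p P) - rhoF n r j p (rhoE n r γ e lam i m P) =
      if i = j then
        rhoH n r e lam i (m + p) P +
          ((γ ^ 2 - ((r : ℂ) + 1)) * (m : ℂ) * (if m + p = 0 then 1 else 0)) • P
      else 0 := by
  simp only [← eOp_apply, ← fOp_apply]
  have h := LinearMap.congr_fun (opComm_eOp_fOp hr γ e lam i j m p) P
  rw [opComm_apply] at h
  refine h.trans ?_
  by_cases hij : i = j
  · rw [if_pos hij, if_pos hij]
    simp only [rhoH, Hcal, LinearMap.add_apply, LinearMap.sum_apply, LinearMap.smul_apply,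
      Module.End.one_apply]
    congr 2
    refine Finset.sum_congr rfl fun k _ => Finset.sum_congr rfl fun l _ => ?_
    split_ifs
    · rw [LinearMap.smul_apply, opSum_normFam_apply]
    · rfl
  · rw [if_neg hij, if_neg hij]
    rfl
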